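/- arXiv:1711.01655 — 2 statements merged into one kernel-verified Lean document; each statement's English description precedes it below -/
import Mathlib

section
/- Let D^{(i)} = CUT(R_i, C_i, d_i) for i = 1,…,s be cut matrices on {1,…,n}, and let V_1,…,V_r be a partition of {1,…,n}, with r ≤ 2^{2s}, such that each R_i and each C_i is a union of some of the atoms V_a. For y with y_a ∈ {0,…,|V_a|} set r'(y)_i := Σ_{a : V_a ⊆ R_i}(2y_a − |V_a|) and c'(y)_i := Σ_{a : V_a ⊆ C_i}(2y_a − |V_a|). Define Z' := Σ_{x∈{−1,1}^n} exp(xᵀ(D^{(1)}+⋯+D^{(s)})x) and Z'' := Σ_y exp(Σ_{i=1}^s r'(y)_i c'(y)_i d_i + Σ_{a=1}^r |V_a|·H(y_a/|V_a|)). Then |log Z' − log Z''| ≤ 2^{2s}·log(n+1). -/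
open Real Finset

/-- The ±1 vector corresponding to a Boolean vector. -/
noncomputable def sv {n : ℕ} (x : Fin n → Bool) : Fin n → ℝ := fun i => if x i then 1 else -1

/-- The quadratic form `xᵀ M x = ∑_{i,j} M_{ij} x_i x_j`. -/
def quad {n : ℕ} (M : Matrix (Fin n) (Fin n) ℝ) (x : Fin n → ℝ) : ℝ :=
  ∑ i, ∑ j, M i j * x i * x j

/-- The Ising partition function `Z = ∑_{x ∈ {−1,1}^n} exp(xᵀ M x)`. -/
noncomputable def partZ {n : ℕ} (M : Matrix (Fin n) (Fin n) ℝ) : ℝ :=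
  ∑ x : Fin n → Bool, Real.exp (quad M (sv x))

/-- `‖M⃗‖₁ = ∑_{i,j} |M_{ij}|`. -/
noncomputable def vecNorm1 {n : ℕ} (M : Matrix (Fin n) (Fin n) ℝ) : ℝ := ∑ i, ∑ j, |M i j|

/-- `‖M⃗‖₂ = (∑_{i,j} M_{ij}²)^{1/2}`. -/
noncomputable def vecNorm2 {n : ℕ} (M : Matrix (Fin n) (Fin n) ℝ) : ℝ :=
  Real.sqrt (∑ i, ∑ j, (M i j) ^ 2)

/-- `‖M⃗‖_∞ = max_{i,j} |M_{ij}|`. -/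
noncomputable def vecNormInf {n : ℕ} (M : Matrix (Fin n) (Fin n) ℝ) : ℝ :=
  ⨆ p : Fin n × Fin n, |M p.1 p.2|

/-- `‖M‖_{∞→1} = sup_{‖x‖_∞ ≤ 1} ‖Mx‖₁`. -/
noncomputable def normInfTo1 {n : ℕ} (M : Matrix (Fin n) (Fin n) ℝ) : ℝ :=
  ⨆ x : {x : Fin n → ℝ // ∀ i, |x i| ≤ 1}, ∑ i, |∑ j, M i j * x.1 j|

/-- The cut matrix `CUT(R, C, d)`: entry `(i,j)` equals `d` if `(i,j) ∈ R × C` and `0` otherwise. -/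
def cutMatrix {n : ℕ} (R C : Finset (Fin n)) (d : ℝ) : Matrix (Fin n) (Fin n) ℝ :=
  fun i j => if i ∈ R ∧ j ∈ C then d else 0

/-- `r'(y)ᵢ = ∑_{a : V_a ⊆ R_i} (2 y_a − |V_a|)`, the net spin in `R_i` for the profile `y`. -/
noncomputable def netSpin {n r s : ℕ} (V : Fin r → Finset (Fin n)) (R : Fin s → Finset (Fin n))
    (y : Fin r → ℕ) (i : Fin s) : ℝ :=
  ∑ a ∈ Finset.univ.filter (fun a => V a ⊆ R i), (2 * (y a : ℝ) - (V a).card)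

/-- The binary entropy function `H(p) = −p log p − (1−p) log(1−p)` (with `H(0) = H(1) = 0`,
since `Real.log 0 = 0`). -/
noncomputable def binH (p : ℝ) : ℝ := -p * Real.log p - (1 - p) * Real.log (1 - p)

/-- The sequence `j ↦ k ^ j / j!` is maximal at `j = k`. -/
theorem factorial_mul_pow_le_factorial_mul_pow_self (k j : ℕ) :
    k.factorial * k ^ j ≤ j.factorial * k ^ k := by
  rcases le_total k j with h | h
  · calc k.factorial * k ^ j = k.factorial * k ^ (j - k) * k ^ k := by
          rw [mul_assoc, ← pow_add, Nat.sub_add_cancel h]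
      _ ≤ j.factorial * k ^ k := by
          gcongr
          exact Nat.factorial_mul_pow_sub_le_factorial h
  · have hfac : k.factorial ≤ j.factorial * k ^ (k - j) := by
      rw [← Nat.factorial_mul_descFactorial (Nat.sub_le k j), Nat.sub_sub_self h]
      gcongr
      exact Nat.descFactorial_le_pow _ _
    calc k.factorial * k ^ j ≤ j.factorial * k ^ (k - j) * k ^ j := by gcongr
      _ = j.factorial * k ^ k := by rw [mul_assoc, ← pow_add, Nat.sub_add_cancel h]

/-- The largest term of the binomial expansion of `(k + (m - k)) ^ m` is the `k`-th one. -/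
theorem choose_mul_pow_mul_pow_le {m k j : ℕ} (hk : k ≤ m) (hj : j ≤ m) :
    k ^ j * (m - k) ^ (m - j) * m.choose j ≤ k ^ k * (m - k) ^ (m - k) * m.choose k := by
  have h := Nat.mul_le_mul (factorial_mul_pow_le_factorial_mul_pow_self k j)
    (factorial_mul_pow_le_factorial_mul_pow_self (m - k) (m - j))
  have hcj := Nat.choose_mul_factorial_mul_factorial hj
  have hck := Nat.choose_mul_factorial_mul_factorial hk
  have hpos : 0 < k.factorial * (m - k).factorial * (j.factorial * (m - j).factorial) := by
    positivity
  refine Nat.le_of_mul_le_mul_right ?_ hpos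
  calc k ^ j * (m - k) ^ (m - j) * m.choose j *
        (k.factorial * (m - k).factorial * (j.factorial * (m - j).factorial))
      = (k.factorial * k ^ j * ((m - k).factorial * (m - k) ^ (m - j))) *
          (m.choose j * j.factorial * (m - j).factorial) := by ring
    _ ≤ (j.factorial * k ^ k * ((m - j).factorial * (m - k) ^ (m - k))) *
          (m.choose j * j.factorial * (m - j).factorial) := by gcongr
    _ = (j.factorial * k ^ k * ((m - j).factorial * (m - k) ^ (m - k))) *
          (m.choose k * k.factorial * (m - k).factorial) := by rw [hcj, hck]
    _ = _ := by ring

theorem pow_self_eq_sum_range {m k : ℕ} (hk : k ≤ m) :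
    m ^ m = ∑ j ∈ range (m + 1), k ^ j * (m - k) ^ (m - j) * m.choose j := by
  simpa [Nat.add_sub_cancel' hk] using add_pow k (m - k) m

theorem mul_log_div_eq {k m : ℝ} (hm : m ≠ 0) :
    m * (k / m * Real.log (k / m)) = k * Real.log k - k * Real.log m := by
  rcases eq_or_ne k 0 with rfl | hk
  · simp
  · rw [Real.log_div hk hm]
    field_simp

theorem exp_mul_log_natCast (k : ℕ) : Real.exp (k * Real.log k) = (k : ℝ) ^ k := by
  rcases Nat.eq_zero_or_pos k with rfl | hk
  · simp
  · rw [Real.exp_nat_mul, Real.exp_log (by exact_mod_cast hk)]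

/-- `exp (m H(k/m)) = m ^ m / (k ^ k (m - k) ^ (m - k))`, without division. -/
theorem exp_mul_binH_mul {m k : ℕ} (hk : k ≤ m) :
    Real.exp ((m : ℝ) * binH ((k : ℝ) / m)) * ((k ^ k * (m - k) ^ (m - k) : ℕ) : ℝ) =
      ((m ^ m : ℕ) : ℝ) := by
  rcases Nat.eq_zero_or_pos m with rfl | hm
  · obtain rfl : k = 0 := by omega
    simp
  have hm' : (m : ℝ) ≠ 0 := by positivity
  have hsub : 1 - (k : ℝ) / m = ((m - k : ℕ) : ℝ) / m := by
    rw [Nat.cast_sub hk]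
    field_simp
  push_cast
  rw [← exp_mul_log_natCast k, ← exp_mul_log_natCast m,
    ← exp_mul_log_natCast (m - k), ← Real.exp_add, ← Real.exp_add]
  congr 1
  have h1 := mul_log_div_eq (k := k) hm'
  have h2 := mul_log_div_eq (k := ((m - k : ℕ) : ℝ)) hm'
  rw [binH, hsub]
  have h3 : ((m - k : ℕ) : ℝ) = m - k := Nat.cast_sub hk
  have h4 : ((m - k : ℕ) : ℝ) * Real.log m = m * Real.log m - k * Real.log m := by
    rw [h3]; ring
  linarith

theorem pow_self_mul_pow_self_pos (k l : ℕ) : 0 < k ^ k * l ^ l :=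
  Nat.mul_pos Nat.pow_self_pos Nat.pow_self_pos

theorem choose_le_exp_mul_binH {m k : ℕ} (hk : k ≤ m) :
    (m.choose k : ℝ) ≤ Real.exp ((m : ℝ) * binH ((k : ℝ) / m)) := by
  have hpos : (0 : ℝ) < ((k ^ k * (m - k) ^ (m - k) : ℕ) : ℝ) := by
    exact_mod_cast pow_self_mul_pow_self_pos k (m - k)
  refine le_of_mul_le_mul_right ?_ hpos
  rw [exp_mul_binH_mul hk, ← Nat.cast_mul, Nat.cast_le, pow_self_eq_sum_range hk, mul_comm]
  exact single_le_sum (f := fun j => k ^ j * (m - k) ^ (m - j) * m.choose j)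
    (fun _ _ => Nat.zero_le _) (mem_range.2 (Nat.lt_succ_of_le hk))

theorem exp_mul_binH_le {m k : ℕ} (hk : k ≤ m) :
    Real.exp ((m : ℝ) * binH ((k : ℝ) / m)) ≤ (m + 1) * m.choose k := by
  have hpos : (0 : ℝ) < ((k ^ k * (m - k) ^ (m - k) : ℕ) : ℝ) := by
    exact_mod_cast pow_self_mul_pow_self_pos k (m - k)
  refine le_of_mul_le_mul_right ?_ hpos
  rw [exp_mul_binH_mul hk]
  have h : m ^ m ≤ (m + 1) * (k ^ k * (m - k) ^ (m - k) * m.choose k) := by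
    rw [pow_self_eq_sum_range hk]
    refine (sum_le_card_nsmul _ _ _ fun j hj =>
      choose_mul_pow_mul_pow_le hk (Nat.lt_succ_iff.1 (mem_range.1 hj))).trans_eq ?_
    simp
  calc ((m ^ m : ℕ) : ℝ) ≤ (((m + 1) * (k ^ k * (m - k) ^ (m - k) * m.choose k) : ℕ) : ℝ) := by
        exact_mod_cast h
    _ = _ := by push_cast; ring

/-- The number of `true` coordinates of `x` in each atom of `V`. -/
def profile {n r : ℕ} (V : Fin r → Finset (Fin n)) (x : Fin n → Bool) (a : Fin r) : ℕ :=
  ((V a).filter fun i => x i = true).card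

theorem profile_mem_piFinset {n r : ℕ} (V : Fin r → Finset (Fin n)) (x : Fin n → Bool) :
    profile V x ∈ Fintype.piFinset fun a => range ((V a).card + 1) :=
  Fintype.mem_piFinset.2 fun _ => mem_range.2 (Nat.lt_succ_of_le (card_filter_le _ _))

theorem card_profile_fiber {n r : ℕ} (V : Fin r → Finset (Fin n))
    (hdisj : ∀ a b, a ≠ b → Disjoint (V a) (V b)) (hcover : ∀ i : Fin n, ∃ a, i ∈ V a)
    (y : Fin r → ℕ) :
    (univ.filter fun x => profile V x = y).card = ∏ a, (V a).card.choose (y a) := by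
  have huniq : ∀ {i a b}, i ∈ V a → i ∈ V b → a = b := fun {i a b} ha hb => by
    by_contra hab
    exact disjoint_left.1 (hdisj a b hab) ha hb
  simp_rw [← card_powersetCard]
  rw [← Fintype.card_piFinset]
  refine card_nbij' (fun x a => (V a).filter fun i => x i = true)
    (fun f i => decide (∃ a, i ∈ f a)) ?_ ?_ ?_ ?_
  · intro x hx
    have hx' : profile V x = y := by simpa using hx
    simp only [Fintype.mem_piFinset, mem_coe, mem_powersetCard]
    exact fun a => ⟨filter_subset _ _, congrFun hx' a⟩
  · intro f hf
    have hf' : ∀ a, f a ⊆ V a ∧ (f a).card = y a := by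
      simpa only [mem_coe, Fintype.mem_piFinset, mem_powersetCard] using hf
    simp only [mem_coe, mem_filter_univ]
    funext a
    rw [← (hf' a).2, profile]
    congr 1
    ext i
    simp only [mem_filter, decide_eq_true_eq]
    constructor
    · rintro ⟨hi, b, hb⟩
      rwa [huniq hi ((hf' b).1 hb)]
    · exact fun hi => ⟨(hf' a).1 hi, a, hi⟩
  · intro x _
    funext i
    obtain ⟨a, ha⟩ := hcover i
    rw [Bool.eq_iff_iff, decide_eq_true_eq]
    simp only [mem_filter]
    exact ⟨fun ⟨_, h⟩ => h.2, fun h => ⟨a, ha, h⟩⟩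
  · intro f hf
    have hf' : ∀ a, f a ⊆ V a ∧ (f a).card = y a := by
      simpa only [mem_coe, Fintype.mem_piFinset, mem_powersetCard] using hf
    funext a
    ext i
    simp only [mem_filter, decide_eq_true_eq]
    constructor
    · rintro ⟨hi, b, hb⟩
      rwa [huniq hi ((hf' b).1 hb)]
    · exact fun hi => ⟨(hf' a).1 hi, a, hi⟩

theorem quad_sum_cutMatrix {n s : ℕ} (R C : Fin s → Finset (Fin n)) (d : Fin s → ℝ)
    (v : Fin n → ℝ) :
    quad (∑ i, cutMatrix (R i) (C i) (d i)) v =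
      ∑ i, (∑ j ∈ R i, v j) * (∑ j ∈ C i, v j) * d i := by
  simp only [quad, Matrix.sum_apply, sum_mul]
  calc _ = ∑ j, ∑ i, ∑ k, cutMatrix (R i) (C i) (d i) j k * v j * v k :=
        sum_congr rfl fun j _ => sum_comm
    _ = ∑ i, ∑ j, ∑ k, cutMatrix (R i) (C i) (d i) j k * v j * v k := sum_comm
    _ = _ := by
      refine sum_congr rfl fun i _ => ?_
      rw [← sum_filter_add_sum_filter_not univ (· ∈ R i)]
      have hz : ∑ j ∈ univ.filter (fun j => ¬ j ∈ R i),
          ∑ k, cutMatrix (R i) (C i) (d i) j k * v j * v k = 0 :=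
        sum_eq_zero fun j hj => sum_eq_zero fun k _ => by
          simp [cutMatrix, (mem_filter.1 hj).2]
      rw [hz, add_zero, filter_mem_eq_inter, univ_inter]
      refine sum_congr rfl fun j hj => ?_
      rw [mul_sum, sum_mul, ← sum_subset (subset_univ (C i))]
      · refine sum_congr rfl fun k hk => ?_
        simp only [cutMatrix, hj, hk, and_self, if_true]
        ring
      · intro k _ hk
        simp [cutMatrix, hk]

theorem sum_sv_eq {n : ℕ} (x : Fin n → Bool) (A : Finset (Fin n)) :
    ∑ i ∈ A, sv x i = 2 * ((A.filter fun i => x i = true).card : ℝ) - A.card := by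
  have h : ∀ i, sv x i = 2 * (if x i = true then 1 else 0) - 1 := fun i => by
    unfold sv
    split_ifs <;> norm_num
  simp only [h, sum_sub_distrib, ← mul_sum, sum_boole, sum_const, nsmul_eq_mul, mul_one]

theorem sum_sv_eq_netSpin {n r s : ℕ} (V : Fin r → Finset (Fin n))
    (hdisj : ∀ a b, a ≠ b → Disjoint (V a) (V b)) (R : Fin s → Finset (Fin n))
    (hR : ∀ i, ∃ S : Finset (Fin r), R i = S.biUnion V) (x : Fin n → Bool) (i : Fin s) :
    ∑ j ∈ R i, sv x j = netSpin V R (profile V x) i := by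
  have hU : R i = (univ.filter fun a => V a ⊆ R i).biUnion V := by
    obtain ⟨S, hS⟩ := hR i
    apply Subset.antisymm
    · intro j hj
      rw [hS] at hj
      obtain ⟨a, ha, hja⟩ := mem_biUnion.1 hj
      refine mem_biUnion.2 ⟨a, mem_filter.2 ⟨mem_univ _, ?_⟩, hja⟩
      rw [hS]
      exact subset_biUnion_of_mem V ha
    · exact biUnion_subset.2 fun a ha => (mem_filter.1 ha).2
  conv_lhs => rw [hU]
  rw [sum_biUnion fun a _ b _ hab => hdisj a b hab]
  exact sum_congr rfl fun a _ => sum_sv_eq x (V a)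

theorem partition_function_eq_sum_profiles {n s r : ℕ} (R C : Fin s → Finset (Fin n))
    (d : Fin s → ℝ) (V : Fin r → Finset (Fin n))
    (hdisj : ∀ a b, a ≠ b → Disjoint (V a) (V b)) (hcover : ∀ i : Fin n, ∃ a, i ∈ V a)
    (hR : ∀ i, ∃ S : Finset (Fin r), R i = S.biUnion V)
    (hC : ∀ i, ∃ S : Finset (Fin r), C i = S.biUnion V) :
    ∑ x : Fin n → Bool, Real.exp (quad (∑ i, cutMatrix (R i) (C i) (d i)) (sv x)) =
      ∑ y ∈ Fintype.piFinset (fun a => range ((V a).card + 1)),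
        Real.exp (∑ i, netSpin V R y i * netSpin V C y i * d i) *
          ∏ a, ((V a).card.choose (y a) : ℝ) := by
  rw [← sum_fiberwise_of_maps_to (fun x _ => profile_mem_piFinset V x)]
  refine sum_congr rfl fun y _ => ?_
  rw [← Nat.cast_prod, ← card_profile_fiber V hdisj hcover y, mul_comm, ← nsmul_eq_mul]
  refine sum_eq_card_nsmul fun x hx => ?_
  rw [quad_sum_cutMatrix, ← (mem_filter.1 hx).2]
  simp only [sum_sv_eq_netSpin V hdisj R hR, sum_sv_eq_netSpin V hdisj C hC]

theorem stmt7 (n s r : ℕ) (R C : Fin s → Finset (Fin n)) (d : Fin s → ℝ)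
    (V : Fin r → Finset (Fin n))
    (hdisj : ∀ a b, a ≠ b → Disjoint (V a) (V b))
    (hcover : ∀ i : Fin n, ∃ a, i ∈ V a)
    (hr : r ≤ 2 ^ (2 * s))
    (hR : ∀ i, ∃ S : Finset (Fin r), R i = S.biUnion V)
    (hC : ∀ i, ∃ S : Finset (Fin r), C i = S.biUnion V) :
    |Real.log (∑ x : Fin n → Bool,
          Real.exp (quad (∑ i, cutMatrix (R i) (C i) (d i)) (sv x))) -
      Real.log (∑ y ∈ Fintype.piFinset (fun a => Finset.range ((V a).card + 1)),
          Real.exp (∑ i, netSpin V R y i * netSpin V C y i * d i +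
            ∑ a, ((V a).card : ℝ) * binH ((y a : ℝ) / ((V a).card : ℝ))))|
      ≤ (2 : ℝ) ^ (2 * s) * Real.log (n + 1) := by
  have hle : ∀ {y : Fin r → ℕ}, y ∈ Fintype.piFinset (fun a => range ((V a).card + 1)) →
      ∀ a, y a ≤ (V a).card := fun hy a =>
    Nat.lt_succ_iff.1 (mem_range.1 (Fintype.mem_piFinset.1 hy a))
  have hpos : (0 : ℝ) < ∑ x : Fin n → Bool,
      Real.exp (quad (∑ i, cutMatrix (R i) (C i) (d i)) (sv x)) :=
    sum_pos (fun _ _ => Real.exp_pos _) univ_nonempty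
  have heq := partition_function_eq_sum_profiles R C d V hdisj hcover hR hC
  set Z₁ := ∑ x : Fin n → Bool, Real.exp (quad (∑ i, cutMatrix (R i) (C i) (d i)) (sv x))
  set Z₂ := ∑ y ∈ Fintype.piFinset (fun a => Finset.range ((V a).card + 1)),
    Real.exp (∑ i, netSpin V R y i * netSpin V C y i * d i +
      ∑ a, ((V a).card : ℝ) * binH ((y a : ℝ) / ((V a).card : ℝ))) with hZ₂
  have hlower : Z₁ ≤ Z₂ := by
    rw [heq, hZ₂]
    refine sum_le_sum fun y hy => ?_
    rw [Real.exp_add,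
      Real.exp_sum _ fun a => ((V a).card : ℝ) * binH ((y a : ℝ) / ((V a).card : ℝ))]
    gcongr
    exact choose_le_exp_mul_binH (hle hy _)
  have hupper : Z₂ ≤ ((n : ℝ) + 1) ^ r * Z₁ := by
    rw [heq, hZ₂, mul_sum]
    refine sum_le_sum fun y hy => ?_
    rw [Real.exp_add,
      Real.exp_sum _ fun a => ((V a).card : ℝ) * binH ((y a : ℝ) / ((V a).card : ℝ)),
      mul_left_comm]
    gcongr
    calc ∏ a, Real.exp (((V a).card : ℝ) * binH ((y a : ℝ) / ((V a).card : ℝ)))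
        ≤ ∏ a, (((n : ℝ) + 1) * (V a).card.choose (y a)) := by
          refine prod_le_prod (fun _ _ => (Real.exp_pos _).le) fun a _ =>
            (exp_mul_binH_le (hle hy a)).trans ?_
          gcongr
          simpa using card_le_univ (V a)
      _ = _ := by simp [prod_mul_distrib]
  have hlog := Real.log_le_log hpos hlower
  have hlog' := Real.log_le_log (hpos.trans_le hlower) hupper
  rw [Real.log_mul (by positivity) hpos.ne', Real.log_pow] at hlog'
  have hr' : (r : ℝ) * Real.log (n + 1) ≤ (2 : ℝ) ^ (2 * s) * Real.log (n + 1) := by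
    refine mul_le_mul_of_nonneg_right (by exact_mod_cast hr) (Real.log_nonneg ?_)
    linarith [n.cast_nonneg (α := ℝ)]
  rw [abs_le]
  constructor <;> linarith
end

section
/- Fix n ≥ 2, Δ ∈ (0,1), and a set E of m unordered pairs of distinct elements of {1,…,n}. For M > 0 define symmetric n×n matrices J_M and J'_M with zero diagonal by: (J_M)_{ij} = M/Δ if {i,j} ∈ E and (J_M)_{ij} = M if i ≠ j and {i,j} ∉ E; and (J'_M)_{ij} = M for all i ≠ j. Then (log Z(J_M) − log Z(J'_M))/M tends to 2m·(1/Δ − 1) as M → ∞, where Z(J) := Σ_{x∈{−1,1}^n} exp(xᵀJx). In particular, for every c < 2m(1/Δ − 1) there exists M₀ such that for all M ≥ M₀, log Z(J_M) − log Z(J'_M) ≥ cM. -/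
open Real Finset

lemma abs_sv {n : ℕ} (x : Fin n → Bool) (i : Fin n) : |sv x i| = 1 := by
  unfold sv
  split_ifs <;> simp

/-- For entrywise nonnegative `J`, the quadratic form on spins is at most the sum of the entries. -/
lemma quad_sv_le_sum {n : ℕ} {J : Matrix (Fin n) (Fin n) ℝ} (hJ : ∀ i j, 0 ≤ J i j)
    (x : Fin n → Bool) : quad J (sv x) ≤ ∑ i, ∑ j, J i j := by
  refine Finset.sum_le_sum fun i _ => Finset.sum_le_sum fun j _ => ?_
  calc J i j * sv x i * sv x j ≤ |J i j * sv x i * sv x j| := le_abs_self _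
    _ = J i j := by rw [abs_mul, abs_mul, abs_sv, abs_sv, abs_of_nonneg (hJ i j)]; ring

lemma quad_sv_true {n : ℕ} (J : Matrix (Fin n) (Fin n) ℝ) :
    quad J (sv fun _ => true) = ∑ i, ∑ j, J i j := by
  simp [quad, sv]

lemma exp_sum_le_partZ {n : ℕ} (J : Matrix (Fin n) (Fin n) ℝ) :
    Real.exp (∑ i, ∑ j, J i j) ≤ partZ J := by
  rw [← quad_sv_true]
  exact Finset.single_le_sum (f := fun x : Fin n → Bool => Real.exp (quad J (sv x)))
    (fun x _ => (Real.exp_pos _).le) (Finset.mem_univ fun _ => true)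

lemma sum_le_log_partZ {n : ℕ} (J : Matrix (Fin n) (Fin n) ℝ) :
    ∑ i, ∑ j, J i j ≤ Real.log (partZ J) :=
  (Real.le_log_iff_exp_le ((Real.exp_pos _).trans_le (exp_sum_le_partZ J))).2 (exp_sum_le_partZ J)

lemma log_partZ_le {n : ℕ} {J : Matrix (Fin n) (Fin n) ℝ} (hJ : ∀ i j, 0 ≤ J i j) :
    Real.log (partZ J) ≤ n * Real.log 2 + ∑ i, ∑ j, J i j := by
  have hpos : 0 < partZ J := (Real.exp_pos _).trans_le (exp_sum_le_partZ J)
  have hle : partZ J ≤ 2 ^ n * Real.exp (∑ i, ∑ j, J i j) := by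
    calc partZ J ≤ ∑ _x : Fin n → Bool, Real.exp (∑ i, ∑ j, J i j) :=
          Finset.sum_le_sum fun x _ => Real.exp_le_exp.2 (quad_sv_le_sum hJ x)
      _ = 2 ^ n * Real.exp (∑ i, ∑ j, J i j) := by simp
  calc Real.log (partZ J) ≤ Real.log (2 ^ n * Real.exp (∑ i, ∑ j, J i j)) :=
        Real.log_le_log hpos hle
    _ = n * Real.log 2 + ∑ i, ∑ j, J i j := by
        rw [Real.log_mul (by positivity) (Real.exp_ne_zero _), Real.log_pow, Real.log_exp]

lemma card_filter_mk_eq {α : Type*} [Fintype α] [DecidableEq α] (e : Sym2 α)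
    (he : ¬ e.IsDiag) : #{p : α × α | s(p.1, p.2) = e} = 2 := by
  induction e using Sym2.ind with
  | _ a b =>
    have hab : a ≠ b := he
    rw [← Finset.card_pair (show (a, b) ≠ (b, a) by simp [hab])]
    congr 1
    ext ⟨c, d⟩
    simp

lemma card_filter_mk_mem {α : Type*} [Fintype α] [DecidableEq α] (E : Finset (Sym2 α))
    (hE : ∀ e ∈ E, ¬ e.IsDiag) : #{p : α × α | s(p.1, p.2) ∈ E} = 2 * #E := by
  rw [Finset.card_eq_sum_card_fiberwise (f := fun p : α × α => s(p.1, p.2)) (t := E)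
    (fun p hp => by simpa using hp), mul_comm, ← smul_eq_mul, ← Finset.sum_const]
  refine Finset.sum_congr rfl fun e he => ?_
  rw [← card_filter_mk_eq e (hE e he), Finset.filter_filter]
  congr 1
  ext p
  simp only [Finset.mem_filter, Finset.mem_univ, true_and, and_iff_right_iff_imp]
  rintro rfl
  exact he

theorem stmt18 (n : ℕ) (hn : 2 ≤ n) (Δ : ℝ) (hΔ0 : 0 < Δ) (hΔ1 : Δ < 1)
    (E : Finset (Sym2 (Fin n))) (hE : ∀ e ∈ E, ¬ e.IsDiag) (m : ℕ) (hm : E.card = m)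
    (JM J'M : ℝ → Matrix (Fin n) (Fin n) ℝ)
    (hJM : ∀ (M : ℝ) (i j : Fin n),
      JM M i j = if i = j then 0 else if s(i, j) ∈ E then M / Δ else M)
    (hJ'M : ∀ (M : ℝ) (i j : Fin n), J'M M i j = if i = j then 0 else M) :
    Filter.Tendsto
      (fun M : ℝ => (Real.log (partZ (JM M)) - Real.log (partZ (J'M M))) / M)
      Filter.atTop (nhds (2 * m * (1 / Δ - 1))) ∧
    ∀ c : ℝ, c < 2 * m * (1 / Δ - 1) → ∃ M₀ : ℝ, ∀ M ≥ M₀,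
      Real.log (partZ (JM M)) - Real.log (partZ (J'M M)) ≥ c * M := by
  set L : ℝ := 2 * m * (1 / Δ - 1) with hL
  set K : ℝ := n * Real.log 2 with hK
  have hK0 : 0 ≤ K := by positivity
  have hsum (M : ℝ) : ∑ i, ∑ j, JM M i j = (∑ i, ∑ j, J'M M i j) + L * M := by
    have hterm (i j : Fin n) :
        JM M i j = J'M M i j + if s(i, j) ∈ E then M * (1 / Δ - 1) else 0 := by
      rw [hJM, hJ'M]
      by_cases hij : i = j
      · subst hij
        have : s(i, i) ∉ E := fun h => hE _ h rfl
        simp [this]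
      · by_cases hmem : s(i, j) ∈ E
        · simp only [hij, hmem, if_true, if_false]
          ring
        · simp [hij, hmem]
    have hcount : ∑ i, ∑ j, (if s(i, j) ∈ E then M * (1 / Δ - 1) else 0) = L * M := by
      rw [← Fintype.sum_prod_type' (f := fun i j : Fin n =>
        if s(i, j) ∈ E then M * (1 / Δ - 1) else 0), ← Finset.sum_filter, Finset.sum_const,
        card_filter_mk_mem E hE, hm, nsmul_eq_mul, hL]
      push_cast
      ring
    simp only [hterm, Finset.sum_add_distrib, hcount]
  have hbound (M : ℝ) (hM : 0 ≤ M) :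
      |Real.log (partZ (JM M)) - Real.log (partZ (J'M M)) - L * M| ≤ K := by
    have hJ0 (i j : Fin n) : 0 ≤ JM M i j := by
      rw [hJM]
      split_ifs <;> positivity
    have hJ'0 (i j : Fin n) : 0 ≤ J'M M i j := by
      rw [hJ'M]
      split_ifs <;> positivity
    have h1 := sum_le_log_partZ (JM M)
    have h2 := sum_le_log_partZ (J'M M)
    have h3 := log_partZ_le hJ0
    have h4 := log_partZ_le hJ'0
    have h5 := hsum M
    rw [abs_le]
    constructor <;> linarith
  constructor
  · rw [tendsto_iff_norm_sub_tendsto_zero]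
    refine squeeze_zero' (Filter.Eventually.of_forall fun _ => norm_nonneg _) ?_
      (tendsto_const_nhds.div_atTop Filter.tendsto_id : Filter.Tendsto (fun M : ℝ => K / M) _ _)
    filter_upwards [Filter.eventually_gt_atTop 0] with M hM
    rw [div_sub' hM.ne', norm_div, Real.norm_eq_abs, Real.norm_of_nonneg hM.le, mul_comm M L]
    exact div_le_div_of_nonneg_right (hbound M hM.le) hM.le
  · intro c hc
    have hLc : 0 < L - c := sub_pos.2 hc
    refine ⟨K / (L - c), fun M hM => ?_⟩
    have hM0 : 0 ≤ M := (div_nonneg hK0 hLc.le).trans hM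
    have h1 := (abs_le.1 (hbound M hM0)).1
    have h2 : K ≤ M * (L - c) := (div_le_iff₀ hLc).1 hM
    linarith
end
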